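/- For any ξ₁, ξ₂, ξ₃ ∈ ℂ the elliptic R-operator satisfies the Yang–Baxter equation on meromorphic functions of three variables: (1⊗Ř(ξ₁₂))(Ř(ξ₁₃)⊗1)(1⊗Ř(ξ₂₃)) = (Ř(ξ₂₃)⊗1)(1⊗Ř(ξ₁₃))(Ř(ξ₁₂)⊗1), where ξᵢⱼ = ξᵢ−ξⱼ. Concretely: for a meromorphic function f(z₁,z₂,z₃) on ℂ³, applying Ř(ξ) to the variables (z₁,z₂) means (Ř(ξ)⊗1 f)(z₁,z₂,z₃) = [θ₁(ξ)θ₁(z₂−z₁−μ)θ₁'(0)/(θ₁(−μ)θ₁(z₂−z₁))]·f(z₂,z₁,z₃) + [θ₁(z₂−z₁−ξ)θ₁'(0)/θ₁(z₂−z₁)]·f(z₁,z₂,z₃), and similarly for (z₂,z₃); the two compositions agree as meromorphic functions. -/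

import Mathlib

open Complex

/-- The Jacobi theta function `θ₁(z, τ)`. -/
noncomputable def theta1 (τ z : ℂ) : ℂ :=
  ∑' m : ℤ, Complex.exp (Real.pi * I * ((m : ℂ) + 1/2)^2 * τ
    + 2 * Real.pi * I * ((m : ℂ) + 1/2) * (z + 1/2))

/-- The horizontal strip `D = {z : |Im z| < Im τ / 2}`. -/
def strip (τ : ℂ) : Set ℂ := {z : ℂ | |z.im| < τ.im / 2}

/-- The elliptic R-operator (raw formula, away from `z₂ - z₁ ∈ ℤ`). -/
noncomputable def Rop (τ μ ξ : ℂ) (f : ℂ → ℂ → ℂ) (z₁ z₂ : ℂ) : ℂ :=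
  theta1 τ ξ * theta1 τ (z₂ - z₁ - μ) * deriv (theta1 τ) 0 /
      (theta1 τ (-μ) * theta1 τ (z₂ - z₁)) * f z₂ z₁
    + theta1 τ (z₂ - z₁ - ξ) * deriv (theta1 τ) 0 / theta1 τ (z₂ - z₁) * f z₁ z₂

/-- `Ř(ξ) ⊗ 1`, acting in the variables `(z₁, z₂)` of a function of three variables. -/
noncomputable def R12 (τ μ ξ : ℂ) (f : ℂ → ℂ → ℂ → ℂ) (z₁ z₂ z₃ : ℂ) : ℂ :=
  Rop τ μ ξ (fun a b => f a b z₃) z₁ z₂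

/-- `1 ⊗ Ř(ξ)`, acting in the variables `(z₂, z₃)` of a function of three variables. -/
noncomputable def R23 (τ μ ξ : ℂ) (f : ℂ → ℂ → ℂ → ℂ) (z₁ z₂ z₃ : ℂ) : ℂ :=
  Rop τ μ ξ (f z₁) z₂ z₃

open Topology

/-- The part of the lattice sum `∑ₛ exp(πiτs²/2 + 2πisx)` over even `s`. -/
noncomputable def thetaEven (τ x : ℂ) : ℂ :=
  ∑' n : ℤ, jacobiTheta₂_term n (2 * x) (2 * τ)

/-- The part of the lattice sum `∑ₛ exp(πiτs²/2 + 2πisx)` over odd `s`. -/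
noncomputable def thetaOdd (τ x : ℂ) : ℂ :=
  ∑' n : ℤ, exp (2 * Real.pi * I * x + Real.pi * I * τ / 2) *
    jacobiTheta₂_term n (2 * x + τ) (2 * τ)

lemma theta1_summand_eq (τ z : ℂ) (m : ℤ) :
    exp (Real.pi * I * ((m : ℂ) + 1/2)^2 * τ + 2 * Real.pi * I * ((m : ℂ) + 1/2) * (z + 1/2)) =
      exp (Real.pi * I * τ / 4 + Real.pi * I * (z + 1/2)) *
        jacobiTheta₂_term m (z + 1/2 + τ/2) τ := by
  rw [jacobiTheta₂_term, ← exp_add]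
  congr 1
  ring

lemma theta1_eq (τ z : ℂ) :
    theta1 τ z = exp (Real.pi * I * τ / 4 + Real.pi * I * (z + 1/2)) *
      jacobiTheta₂ (z + 1/2 + τ/2) τ := by
  simp only [theta1, jacobiTheta₂, theta1_summand_eq, tsum_mul_left]

lemma summable_theta1_summand {τ : ℂ} (hτ : 0 < τ.im) (z : ℂ) :
    Summable fun m : ℤ ↦ exp (Real.pi * I * ((m : ℂ) + 1/2)^2 * τ
      + 2 * Real.pi * I * ((m : ℂ) + 1/2) * (z + 1/2)) := by
  simp only [theta1_summand_eq]
  exact ((summable_jacobiTheta₂_term_iff _ _).2 hτ).mul_left _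

/-- The bijection between `ℤ × ℤ` and two copies of itself, splitting the pairs `(m, n)`
by the parity of `m + n`. -/
def intProdParityEquiv : (ℤ × ℤ) ⊕ (ℤ × ℤ) ≃ ℤ × ℤ where
  toFun := Sum.elim (fun p ↦ (p.1 + p.2, p.1 - p.2 - 1)) (fun p ↦ (p.1 + p.2, p.1 - p.2))
  invFun q := if (q.1 + q.2) % 2 = 1 then Sum.inl ((q.1 + q.2 + 1) / 2, (q.1 - q.2 - 1) / 2)
    else Sum.inr ((q.1 + q.2) / 2, (q.1 - q.2) / 2)
  left_inv := by
    rintro (⟨a, b⟩ | ⟨a, b⟩)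
    · have h : (a + b + (a - b - 1)) % 2 = 1 := by lia
      simp only [Sum.elim_inl, h, if_true]
      congr 2 <;> lia
    · have h : ¬ (a + b + (a - b)) % 2 = 1 := by lia
      simp only [Sum.elim_inr, h, if_false]
      congr 2 <;> lia
  right_inv := by
    rintro ⟨m, n⟩
    dsimp only
    split_ifs with h
    · simp only [Sum.elim_inl, Prod.mk.injEq]
      lia
    · simp only [Sum.elim_inr, Prod.mk.injEq]
      lia

lemma exp_add_int_mul_two_pi_mul_I (w : ℂ) (a : ℤ) :
    exp (w + a * (2 * Real.pi * I)) = exp w := by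
  rw [exp_add, exp_int_mul_two_pi_mul_I, mul_one]

lemma theta1_add_mul_theta1_sub {τ : ℂ} (hτ : 0 < τ.im) (x y : ℂ) :
    theta1 τ (x + y) * theta1 τ (x - y) =
      thetaEven τ x * thetaOdd τ y - thetaOdd τ x * thetaEven τ y := by
  have hτ2 : 0 < (2 * τ).im := by simpa using hτ
  have sE : ∀ z, Summable fun n : ℤ ↦ jacobiTheta₂_term n (2 * z) (2 * τ) := fun z ↦
    (summable_jacobiTheta₂_term_iff _ _).2 hτ2
  have sO : ∀ z, Summable fun n : ℤ ↦ exp (2 * Real.pi * I * z + Real.pi * I * τ / 2) *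
      jacobiTheta₂_term n (2 * z + τ) (2 * τ) := fun z ↦
    ((summable_jacobiTheta₂_term_iff _ _).2 hτ2).mul_left _
  have sT := fun z ↦ summable_theta1_summand hτ z
  have sTT := summable_mul_of_summable_norm (sT (x + y)).norm (sT (x - y)).norm
  rw [theta1, theta1, tsum_mul_tsum_of_summable_norm (sT _).norm (sT _).norm,
    thetaEven, thetaOdd, thetaEven, thetaOdd,
    tsum_mul_tsum_of_summable_norm (sE x).norm (sO y).norm,
    tsum_mul_tsum_of_summable_norm (sO x).norm (sE y).norm,
    ← intProdParityEquiv.tsum_eq, Summable.tsum_sum]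
  · refine (congrArg₂ (· + ·) ?_ ?_).trans (sub_eq_add_neg _ _).symm
    · refine tsum_congr fun ⟨a, b⟩ ↦ ?_
      simp only [intProdParityEquiv, Equiv.coe_fn_mk, Sum.elim_inl, jacobiTheta₂_term, ← exp_add]
      rw [← exp_add_int_mul_two_pi_mul_I _ (-a)]
      congr 1
      push_cast
      ring
    · rw [← tsum_neg]
      refine tsum_congr fun ⟨a, b⟩ ↦ ?_
      simp only [intProdParityEquiv, Equiv.coe_fn_mk, Sum.elim_inr, jacobiTheta₂_term, ← exp_add]
      rw [← exp_add_int_mul_two_pi_mul_I _ (-a), neg_eq_neg_one_mul (exp _),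
        ← exp_pi_mul_I, ← exp_add]
      congr 1
      push_cast
      ring
  · exact (intProdParityEquiv.summable_iff.2 sTT).comp_injective Sum.inl_injective
  · exact (intProdParityEquiv.summable_iff.2 sTT).comp_injective Sum.inr_injective

/-- The three-term identity for `θ₁`. -/
lemma theta1_three_term {τ : ℂ} (hτ : 0 < τ.im) (x y z w : ℂ) :
    theta1 τ (x + y) * theta1 τ (x - y) * (theta1 τ (z + w) * theta1 τ (z - w)) +
      theta1 τ (y + z) * theta1 τ (y - z) * (theta1 τ (x + w) * theta1 τ (x - w)) +
      theta1 τ (z + x) * theta1 τ (z - x) * (theta1 τ (y + w) * theta1 τ (y - w)) = 0 := by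
  simp only [theta1_add_mul_theta1_sub hτ]
  ring

lemma theta1_neg {τ : ℂ} (hτ : 0 < τ.im) (z : ℂ) : theta1 τ (-z) = -theta1 τ z := by
  by_cases h : ∃ s, theta1 τ s ≠ 0
  · obtain ⟨s, hs⟩ := h
    have h1 := theta1_add_mul_theta1_sub hτ ((s + z) / 2) ((s - z) / 2)
    have h2 := theta1_add_mul_theta1_sub hτ ((s - z) / 2) ((s + z) / 2)
    rw [show (s + z) / 2 + (s - z) / 2 = s by ring,
      show (s + z) / 2 - (s - z) / 2 = z by ring] at h1
    rw [show (s - z) / 2 + (s + z) / 2 = s by ring,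
      show (s - z) / 2 - (s + z) / 2 = -z by ring] at h2
    apply mul_left_cancel₀ hs
    linear_combination h1 + h2
  · push Not at h
    simp [h]

lemma theta1_add_one (τ z : ℂ) : theta1 τ (z + 1) = -theta1 τ z := by
  rw [theta1_eq, theta1_eq, show z + 1 + 1/2 + τ/2 = z + 1/2 + τ/2 + 1 by ring,
    jacobiTheta₂_add_left, ← neg_mul, neg_eq_neg_one_mul (exp _), ← exp_pi_mul_I, ← exp_add]
  congr 2
  ring

lemma theta1_add_tau (τ z : ℂ) :
    theta1 τ (z + τ) = -(exp (-(2 * Real.pi * I * z + Real.pi * I * τ)) * theta1 τ z) := by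
  rw [theta1_eq, theta1_eq, show z + τ + 1/2 + τ/2 = z + 1/2 + τ/2 + τ by ring,
    jacobiTheta₂_add_left', ← neg_mul, neg_eq_neg_one_mul (exp _), ← exp_pi_mul_I, ← mul_assoc,
    ← mul_assoc, ← exp_add, ← exp_add, ← exp_add, ← exp_add_int_mul_two_pi_mul_I _ 1]
  congr 2
  push_cast
  ring

lemma differentiable_theta1 {τ : ℂ} (hτ : 0 < τ.im) : Differentiable ℂ (theta1 τ) := by
  intro z
  rw [show theta1 τ = fun z ↦ _ from funext (theta1_eq τ)]
  refine DifferentiableAt.mul (by fun_prop) ?_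
  exact (differentiableAt_jacobiTheta₂_fst (z + 1/2 + τ/2) hτ).comp z
    (f := fun z : ℂ ↦ z + 1/2 + τ/2) (by fun_prop)

/-- A translate of `θ₁` by one of its zeros is an exponential multiple of `θ₁`. -/
lemma exists_theta1_add_eq_of_theta1_eq_zero {τ p z₀ : ℂ} (hτ : 0 < τ.im)
    (h₀ : theta1 τ z₀ ≠ 0) (hp : theta1 τ p = 0) :
    ∃ C k : ℂ, ∀ u, theta1 τ (u + p) = C * exp (k * u) * theta1 τ u := by
  have hd := differentiable_theta1 hτ
  have hdp : Differentiable ℂ fun u ↦ theta1 τ (u + p) := by fun_prop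
  have haddp : ∀ u, HasDerivAt (fun u ↦ theta1 τ (u + p)) (deriv (theta1 τ) (u + p)) u :=
    fun u ↦ (hd (u + p)).hasDerivAt.comp_add_const u p
  obtain ⟨b, hb, hbp⟩ : ∃ b, theta1 τ b ≠ 0 ∧ theta1 τ (b + p) ≠ 0 := by
    by_contra! H
    obtain h | h := AnalyticOnNhd.eq_zero_or_eq_zero_of_mul_eq_zero
      (hd.differentiableOn.analyticOnNhd isOpen_univ)
      (hdp.differentiableOn.analyticOnNhd isOpen_univ)
      (fun z _ ↦ by by_cases hz : theta1 τ z = 0 <;> simp [hz, H]) isPreconnected_univ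
    · exact h₀ (h z₀ trivial)
    · exact h₀ (by simpa using h (z₀ - p) trivial)
  have hmul : ∀ a s, theta1 τ (a + s + p) * theta1 τ a * (theta1 τ (b + p) * theta1 τ (b + s)) =
      theta1 τ (a + p) * theta1 τ (a + s) * (theta1 τ (b + s + p) * theta1 τ b) := by
    intro a s
    have h := theta1_three_term hτ ((a + s + b) / 2) ((a + s + b) / 2 + p)
      ((a + s - b) / 2) ((a - s - b) / 2)
    rw [show (a + s + b) / 2 - ((a + s + b) / 2 + p) = -p by ring, theta1_neg hτ p, hp,
      show (a + s + b) / 2 + p + (a + s - b) / 2 = a + s + p by ring,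
      show (a + s + b) / 2 + p - (a + s - b) / 2 = b + p by ring,
      show (a + s + b) / 2 + (a - s - b) / 2 = a by ring,
      show (a + s + b) / 2 - (a - s - b) / 2 = b + s by ring,
      show (a + s - b) / 2 + (a + s + b) / 2 = a + s by ring,
      show (a + s - b) / 2 - (a + s + b) / 2 = -b by ring,
      show (a + s + b) / 2 + p + (a - s - b) / 2 = a + p by ring,
      show (a + s + b) / 2 + p - (a - s - b) / 2 = b + s + p by ring, theta1_neg hτ b] at h
    linear_combination h
  obtain ⟨k, hk⟩ : ∃ k, ∀ a, deriv (theta1 τ) (a + p) * theta1 τ a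
      - theta1 τ (a + p) * deriv (theta1 τ) a = k * (theta1 τ (a + p) * theta1 τ a) := by
    refine ⟨(deriv (theta1 τ) (b + p) * theta1 τ b - theta1 τ (b + p) * deriv (theta1 τ) b) /
      (theta1 τ (b + p) * theta1 τ b), fun a ↦ ?_⟩
    have d1 : ∀ c, HasDerivAt (fun s ↦ theta1 τ (c + s)) (deriv (theta1 τ) c) 0 := fun c ↦ by
      simpa using (hd (c + 0)).hasDerivAt.comp_const_add c 0
    have d2 : ∀ c, HasDerivAt (fun s ↦ theta1 τ (c + s + p)) (deriv (theta1 τ) (c + p)) 0 :=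
      fun c ↦ by simpa [add_right_comm] using d1 (c + p)
    have L := ((d2 a).mul_const (theta1 τ a)).mul ((d1 b).const_mul (theta1 τ (b + p)))
    have R := ((d1 a).const_mul (theta1 τ (a + p))).mul ((d2 b).mul_const (theta1 τ b))
    have h := (L.congr_of_eventuallyEq (.of_forall fun s ↦ (hmul a s).symm)).unique R
    simp only [add_zero] at h
    rw [div_mul_eq_mul_div, eq_div_iff (mul_ne_zero hbp hb)]
    linear_combination h
  obtain ⟨r, hr, hball⟩ := Metric.eventually_nhds_iff_ball.1
    (hd.continuous.continuousAt.eventually_ne h₀)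
  have hconst : ∀ u ∈ Metric.ball z₀ r,
      HasDerivAt (fun u ↦ theta1 τ (u + p) * exp (-(k * u)) / theta1 τ u) 0 u := by
    intro u hu
    have he : HasDerivAt (fun u ↦ exp (-(k * u))) (exp (-(k * u)) * -(k * 1)) u :=
      (((hasDerivAt_id u).const_mul k).neg).cexp
    refine (((haddp u).mul he).div (hd u).hasDerivAt (hball u hu)).congr_deriv ?_
    rw [div_eq_zero_iff]
    left
    rw [Pi.mul_apply]
    linear_combination exp (-(k * u)) * hk u
  refine ⟨theta1 τ (z₀ + p) * exp (-(k * z₀)) / theta1 τ z₀, k, fun u ↦ ?_⟩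
  set C := theta1 τ (z₀ + p) * exp (-(k * z₀)) / theta1 τ z₀
  have hloc : (fun u ↦ theta1 τ (u + p)) =ᶠ[𝓝 z₀] fun u ↦ C * exp (k * u) * theta1 τ u := by
    filter_upwards [Metric.ball_mem_nhds z₀ hr] with u hu
    have h : theta1 τ (u + p) * exp (-(k * u)) / theta1 τ u = C :=
      Metric.isOpen_ball.is_const_of_deriv_eq_zero (convex_ball z₀ r).isPreconnected
        (fun v hv ↦ (hconst v hv).differentiableAt.differentiableWithinAt)
        (fun v hv ↦ (hconst v hv).deriv) hu (Metric.mem_ball_self hr)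
    rw [← h, exp_neg]
    field_simp [hball u hu]
  exact congrFun (AnalyticOnNhd.eq_of_eventuallyEq
    (analyticOnNhd_univ_iff_differentiable.2 hdp)
    (analyticOnNhd_univ_iff_differentiable.2 (by fun_prop)) hloc) u

/-- Unless it vanishes identically, `θ₁` vanishes only on the lattice `ℤ + ℤτ`. -/
lemma exists_int_of_theta1_eq_zero {τ p z₀ : ℂ} (hτ : 0 < τ.im)
    (h₀ : theta1 τ z₀ ≠ 0) (hp : theta1 τ p = 0) : ∃ a b : ℤ, p = a + b * τ := by
  obtain ⟨C, k, h⟩ := exists_theta1_add_eq_of_theta1_eq_zero hτ h₀ hp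
  have hC : C ≠ 0 := by
    rintro rfl
    exact h₀ (by simpa using h (z₀ - p))
  have hne : C * exp (k * z₀) * theta1 τ z₀ ≠ 0 := by simp [hC, h₀, exp_ne_zero]
  have h1 : exp k = 1 := by
    have := h (z₀ + 1)
    rw [add_right_comm, theta1_add_one, theta1_add_one, h, mul_add, exp_add, mul_one] at this
    apply mul_left_cancel₀ hne
    linear_combination this
  have h2 : exp (k * τ) = exp (-(2 * Real.pi * I * p)) := by
    have := h (z₀ + τ)
    rw [add_right_comm, theta1_add_tau, theta1_add_tau, h, mul_add k, exp_add,
      show -(2 * Real.pi * I * (z₀ + p) + Real.pi * I * τ) = -(2 * Real.pi * I * p)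
        + -(2 * Real.pi * I * z₀ + Real.pi * I * τ) by ring, exp_add] at this
    apply mul_left_cancel₀ (mul_ne_zero hne
      (exp_ne_zero (-(2 * Real.pi * I * z₀ + Real.pi * I * τ))))
    linear_combination this
  obtain ⟨n, rfl⟩ := exp_eq_one_iff.1 h1
  obtain ⟨m, hm⟩ := exp_eq_exp_iff_exists_int.1 h2
  refine ⟨m, -n, ?_⟩
  apply mul_left_cancel₀ two_pi_I_ne_zero
  push_cast
  linear_combination hm

/-- The coefficient of the swapped term in the elliptic R-operator, with `u = z₂ - z₁`. -/
noncomputable def swapCoeff (τ μ ξ u : ℂ) : ℂ :=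
  theta1 τ ξ * theta1 τ (u - μ) * deriv (theta1 τ) 0 / (theta1 τ (-μ) * theta1 τ u)

/-- The coefficient of the unswapped term in the elliptic R-operator, with `u = z₂ - z₁`. -/
noncomputable def diagCoeff (τ ξ u : ℂ) : ℂ :=
  theta1 τ (u - ξ) * deriv (theta1 τ) 0 / theta1 τ u

lemma Rop_eq (τ μ ξ : ℂ) (f : ℂ → ℂ → ℂ) (z₁ z₂ : ℂ) :
    Rop τ μ ξ f z₁ z₂ =
      swapCoeff τ μ ξ (z₂ - z₁) * f z₂ z₁ + diagCoeff τ ξ (z₂ - z₁) * f z₁ z₂ := rfl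

lemma swapCoeff_diagCoeff_relation {τ : ℂ} (hτ : 0 < τ.im) (μ a b : ℂ) {u v : ℂ}
    (hμ : theta1 τ μ ≠ 0) (hu : theta1 τ u ≠ 0) (hv : theta1 τ v ≠ 0)
    (huv : theta1 τ (u + v) ≠ 0) :
    swapCoeff τ μ b u * diagCoeff τ (a + b) (u + v) * diagCoeff τ a (-u)
      + diagCoeff τ b u * diagCoeff τ (a + b) v * swapCoeff τ μ a u =
    diagCoeff τ a v * swapCoeff τ μ (a + b) u * diagCoeff τ b (u + v) := by
  have h := theta1_three_term hτ ((v - b) / 2) ((v - b) / 2 - a) (u + (v - b) / 2) ((v + b) / 2)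
  rw [show (v - b) / 2 + ((v - b) / 2 - a) = v - (a + b) by ring,
    show (v - b) / 2 - ((v - b) / 2 - a) = a by ring,
    show u + (v - b) / 2 + (v + b) / 2 = u + v by ring,
    show u + (v - b) / 2 - (v + b) / 2 = u - b by ring,
    show (v - b) / 2 - a + (u + (v - b) / 2) = u + v - (a + b) by ring,
    show (v - b) / 2 - a - (u + (v - b) / 2) = -u - a by ring,
    show (v - b) / 2 + (v + b) / 2 = v by ring,
    show (v - b) / 2 - (v + b) / 2 = -b by ring,
    show u + (v - b) / 2 + (v - b) / 2 = u + v - b by ring,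
    show u + (v - b) / 2 - (v - b) / 2 = u by ring,
    show (v - b) / 2 - a + (v + b) / 2 = v - a by ring,
    show (v - b) / 2 - a - (v + b) / 2 = -(a + b) by ring,
    theta1_neg hτ b, theta1_neg hτ (a + b)] at h
  simp only [swapCoeff, diagCoeff, theta1_neg hτ μ, theta1_neg hτ u]
  field_simp
  linear_combination -theta1 τ (u - μ) * deriv (theta1 τ) 0 ^ 3 * h

lemma swapCoeff_swapCoeff_diagCoeff_relation {τ : ℂ} (hτ : 0 < τ.im) (μ a b : ℂ) {u v : ℂ}
    (hμ : theta1 τ μ ≠ 0) (hu : theta1 τ u ≠ 0) (hv : theta1 τ v ≠ 0)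
    (huv : theta1 τ (u + v) ≠ 0) :
    swapCoeff τ μ a v * diagCoeff τ (a + b) (u + v) * swapCoeff τ μ b (-v)
      + diagCoeff τ a v * diagCoeff τ (a + b) u * diagCoeff τ b v =
    swapCoeff τ μ b u * diagCoeff τ (a + b) (u + v) * swapCoeff τ μ a (-u)
      + diagCoeff τ b u * diagCoeff τ (a + b) v * diagCoeff τ a u := by
  have h₁ := theta1_three_term hτ u v μ 0
  have h₂ := theta1_three_term hτ (u - (a + b) / 2) ((a + b) / 2) (v - (a + b) / 2) ((a - b) / 2)
  simp only [add_zero, sub_zero] at h₁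
  rw [show μ - u = -(u - μ) by ring, theta1_neg hτ (u - μ)] at h₁
  rw [show u - (a + b) / 2 + (a + b) / 2 = u by ring,
    show u - (a + b) / 2 - (a + b) / 2 = u - (a + b) by ring,
    show v - (a + b) / 2 + (a - b) / 2 = v - b by ring,
    show v - (a + b) / 2 - (a - b) / 2 = v - a by ring,
    show (a + b) / 2 + (v - (a + b) / 2) = v by ring,
    show (a + b) / 2 - (v - (a + b) / 2) = -(v - (a + b)) by ring,
    show u - (a + b) / 2 + (a - b) / 2 = u - b by ring,
    show u - (a + b) / 2 - (a - b) / 2 = u - a by ring,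
    show v - (a + b) / 2 + (u - (a + b) / 2) = u + v - (a + b) by ring,
    show v - (a + b) / 2 - (u - (a + b) / 2) = -(u - v) by ring,
    show (a + b) / 2 + (a - b) / 2 = a by ring,
    show (a + b) / 2 - (a - b) / 2 = b by ring,
    theta1_neg hτ (v - (a + b)), theta1_neg hτ (u - v)] at h₂
  simp only [swapCoeff, diagCoeff, theta1_neg hτ μ, theta1_neg hτ u, theta1_neg hτ v,
    show -u - μ = -(μ + u) by ring, show -v - μ = -(v + μ) by ring, theta1_neg hτ (μ + u),
    theta1_neg hτ (v + μ)]
  field_simp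
  linear_combination deriv (theta1 τ) 0 ^ 3 *
    (theta1 τ a * theta1 τ b * theta1 τ (u + v - (a + b)) * h₁
      + theta1 τ μ ^ 2 * theta1 τ (u + v) * h₂)

/-- The Yang–Baxter equation for the elliptic R-operator, as an identity of
meromorphic functions: both sides agree wherever the denominators do not vanish. -/
theorem elliptic_R_yang_baxter (τ : ℂ) (hτ : 0 < τ.im) (μ : ℂ)
    (hμ : ¬∃ a b : ℤ, μ = (a : ℂ) + (b : ℂ) * τ)
    (ξ₁ ξ₂ ξ₃ : ℂ) (f : ℂ → ℂ → ℂ → ℂ) (z₁ z₂ z₃ : ℂ)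
    (h12 : theta1 τ (z₂ - z₁) ≠ 0) (h21 : theta1 τ (z₁ - z₂) ≠ 0)
    (h13 : theta1 τ (z₃ - z₁) ≠ 0) (h31 : theta1 τ (z₁ - z₃) ≠ 0)
    (h23 : theta1 τ (z₃ - z₂) ≠ 0) (h32 : theta1 τ (z₂ - z₃) ≠ 0) :
    R23 τ μ (ξ₁ - ξ₂) (R12 τ μ (ξ₁ - ξ₃) (R23 τ μ (ξ₂ - ξ₃) f)) z₁ z₂ z₃ =
    R12 τ μ (ξ₂ - ξ₃) (R23 τ μ (ξ₁ - ξ₃) (R12 τ μ (ξ₁ - ξ₂) f)) z₁ z₂ z₃ := by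
  have hμ' : theta1 τ μ ≠ 0 := fun h ↦ hμ (exists_int_of_theta1_eq_zero hτ h12 h)
  have huv : theta1 τ (z₂ - z₁ + (z₃ - z₂)) ≠ 0 := by
    rwa [show z₂ - z₁ + (z₃ - z₂) = z₃ - z₁ by ring]
  have huv' : theta1 τ (z₃ - z₂ + (z₂ - z₁)) ≠ 0 := by rwa [add_comm]
  have e₁ := swapCoeff_diagCoeff_relation hτ μ (ξ₁ - ξ₂) (ξ₂ - ξ₃) hμ' h12 h23 huv
  have e₂ := swapCoeff_diagCoeff_relation hτ μ (ξ₂ - ξ₃) (ξ₁ - ξ₂) hμ' h23 h12 huv'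
  have e₃ := swapCoeff_swapCoeff_diagCoeff_relation hτ μ (ξ₁ - ξ₂) (ξ₂ - ξ₃) hμ' h12 h23 huv
  rw [show ξ₁ - ξ₂ + (ξ₂ - ξ₃) = ξ₁ - ξ₃ by ring, neg_sub,
    show z₂ - z₁ + (z₃ - z₂) = z₃ - z₁ by ring] at e₁ e₃
  rw [show ξ₂ - ξ₃ + (ξ₁ - ξ₂) = ξ₁ - ξ₃ by ring, neg_sub,
    show z₃ - z₂ + (z₂ - z₁) = z₃ - z₁ by ring] at e₂
  rw [neg_sub] at e₃
  have e₄ : swapCoeff τ μ (ξ₁ - ξ₂) (z₃ - z₂) * swapCoeff τ μ (ξ₁ - ξ₃) (z₃ - z₁) =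
      swapCoeff τ μ (ξ₁ - ξ₃) (z₃ - z₂) * swapCoeff τ μ (ξ₁ - ξ₂) (z₃ - z₁) := by
    simp only [swapCoeff]
    ring
  have e₅ : swapCoeff τ μ (ξ₁ - ξ₃) (z₂ - z₁) * swapCoeff τ μ (ξ₂ - ξ₃) (z₃ - z₁) =
      swapCoeff τ μ (ξ₂ - ξ₃) (z₂ - z₁) * swapCoeff τ μ (ξ₁ - ξ₃) (z₃ - z₁) := by
    simp only [swapCoeff]
    ring
  simp only [R12, R23, Rop_eq]
  linear_combination f z₁ z₂ z₃ * e₃ - f z₂ z₁ z₃ * e₁ + f z₁ z₃ z₂ * e₂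
    + f z₃ z₁ z₂ * diagCoeff τ (ξ₂ - ξ₃) (z₂ - z₁) * e₄
    + f z₂ z₃ z₁ * diagCoeff τ (ξ₁ - ξ₂) (z₃ - z₂) * e₅
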